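/- arXiv:2008.04784 — 2 statements merged into one kernel-verified Lean document; each statement's English description precedes it below -/
import Mathlib

section
/- Let p be a prime and let G be a finite group acting faithfully and transitively on a finite set A. Suppose the congruence lattice of the G-set A is isomorphic to M_{p+1} (i.e., the set of congruences r with ⊥ < r < ⊤ has exactly p + 1 elements, and any two distinct such congruences r, r' satisfy r ⊓ r' = ⊥ and r ⊔ r' = ⊤ in the setoid lattice), and that |A| < 2(p + 1). Then G is isomorphic to the dihedral group D_{2p} of order 2p, |A| = 2p, and the action is regular (i.e., transitive with trivial stabilizers: stabilizer G a = ⊥ for every a ∈ A). -/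
open MulAction

/-- If `k` pairwise disjoint nonempty sets lie in a set with at most `2k - 2` elements, then at
least two of them are singletons. -/
theorem Finset.exists_ne_card_eq_one {ι α : Type*} [DecidableEq α] {S : Finset ι}
    {f : ι → Finset α} {T : Finset α} (hdisj : (S : Set ι).PairwiseDisjoint f)
    (hne : ∀ i ∈ S, (f i).Nonempty) (hT : ∀ i ∈ S, f i ⊆ T) (hcard : T.card + 2 ≤ 2 * S.card) :
    ∃ i ∈ S, ∃ j ∈ S, i ≠ j ∧ (f i).card = 1 ∧ (f j).card = 1 := by
  have hle : ∑ i ∈ S, (f i).card ≤ T.card := by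
    rw [← Finset.card_biUnion hdisj]
    exact Finset.card_le_card (Finset.biUnion_subset.2 hT)
  have hge : ∑ i ∈ S, 2 ≤ ∑ i ∈ S, ((f i).card + if (f i).card = 1 then 1 else 0) := by
    refine Finset.sum_le_sum fun i hi => ?_
    have := (hne i hi).card_pos
    split_ifs <;> omega
  rw [Finset.sum_add_distrib, ← Finset.card_filter, Finset.sum_const, smul_eq_mul] at hge
  obtain ⟨i, hi, j, hj, hij⟩ := Finset.one_lt_card.1
    (show 1 < (S.filter fun i => (f i).card = 1).card by omega)
  rw [Finset.mem_filter] at hi hj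
  exact ⟨i, hi.1, j, hj.1, hij, hi.2, hj.2⟩

/-- A predicate invariant under two setoids whose join is `⊤` holds everywhere once it holds
somewhere. -/
theorem Setoid.forall_of_sup_eq_top {A : Type*} {r₁ r₂ : Setoid A} (htop : r₁ ⊔ r₂ = ⊤)
    {P : A → Prop} (h₁ : ∀ x y, r₁ x y → P x → P y) (h₂ : ∀ x y, r₂ x y → P x → P y)
    {a : A} (ha : P a) (x : A) : P x := by
  have hle : r₁ ⊔ r₂ ≤ Setoid.ker P := sup_le
    (fun {x y} h => propext ⟨h₁ x y h, h₁ y x (r₁.symm h)⟩)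
    (fun {x y} h => propext ⟨h₂ x y h, h₂ y x (r₂.symm h)⟩)
  rw [htop] at hle
  have : P a = P x := hle (x := a) (y := x) trivial
  exact this ▸ ha

/-- Every class of `r` has at most two elements. -/
def Setoid.HasPairClasses {A : Type*} (r : Setoid A) : Prop :=
  ∀ x y z, r x y → r x z → y ≠ x → z ≠ x → y = z

section Action

variable {G A : Type*} [Group G] [MulAction G A]

theorem Setoid.hasPairClasses_of_smul [IsPretransitive G A] {r : Setoid A}
    (hr : ∀ (g : G) (x y : A), r x y → r (g • x) (g • y)) {a b : A}
    (hb : ∀ x, r a x → x ≠ a → x = b) : r.HasPairClasses := by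
  intro x y z hy hz hyx hzx
  obtain ⟨g, rfl⟩ := exists_smul_eq G x a
  have key : ∀ w, r x w → w ≠ x → g • w = b := fun w hw hwx =>
    hb _ (hr g _ _ hw) fun h => hwx (smul_left_cancel g h)
  exact smul_left_cancel g ((key y hy hyx).trans (key z hz hzx).symm)

theorem Setoid.exists_ne_of_bot_lt [IsPretransitive G A] {r : Setoid A}
    (hr : ∀ (g : G) (x y : A), r x y → r (g • x) (g • y)) (hbot : ⊥ < r) (a : A) :
    ∃ x, r a x ∧ x ≠ a := by
  by_contra! h
  refine hbot.not_ge fun {x y} hxy => ?_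
  obtain ⟨g, rfl⟩ := exists_smul_eq G x a
  exact (smul_left_cancel g (h _ (hr g _ _ hxy))).symm

/-- Two congruences with classes of size at most two and join `⊤` force a faithful action to be
semiregular. -/
theorem eq_one_of_smul_eq_of_hasPairClasses [FaithfulSMul G A] {r₁ r₂ : Setoid A}
    (hr₁ : ∀ (g : G) (x y : A), r₁ x y → r₁ (g • x) (g • y))
    (hr₂ : ∀ (g : G) (x y : A), r₂ x y → r₂ (g • x) (g • y))
    (hp₁ : r₁.HasPairClasses) (hp₂ : r₂.HasPairClasses) (htop : r₁ ⊔ r₂ = ⊤)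
    {g : G} {a : A} (hg : g • a = a) : g = 1 := by
  have step : ∀ r : Setoid A, (∀ (g : G) (x y : A), r x y → r (g • x) (g • y)) →
      r.HasPairClasses → ∀ x y, r x y → g • x = x → g • y = y := by
    intro r hr hp x y hxy hx
    by_cases hyx : y = x
    · rwa [hyx]
    · refine hp x _ _ ?_ hxy (fun h => hyx (smul_left_cancel g (h.trans hx.symm))) hyx
      simpa only [hx] using hr g x y hxy
  refine FaithfulSMul.eq_of_smul_eq_smul (α := A) fun x => ?_
  rw [one_smul]
  exact Setoid.forall_of_sup_eq_top htop (step r₁ hr₁ hp₁) (step r₂ hr₂ hp₂) hg x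

theorem mul_self_eq_one_of_hasPairClasses {r : Setoid A}
    (hr : ∀ (g : G) (x y : A), r x y → r (g • x) (g • y)) (hp : r.HasPairClasses) {a : A}
    (hfree : ∀ g : G, g • a = a → g = 1) {s : G} (hs : r a (s • a)) (hsa : s • a ≠ a) :
    s * s = 1 := by
  refine hfree _ ?_
  rw [mul_smul]
  exact hp (s • a) _ _ (hr s _ _ hs) (r.symm hs) (fun h => hsa (smul_left_cancel s h)) hsa.symm

theorem closure_pair_eq_top_of_hasPairClasses {r₁ r₂ : Setoid A}
    (hr₁ : ∀ (g : G) (x y : A), r₁ x y → r₁ (g • x) (g • y))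
    (hr₂ : ∀ (g : G) (x y : A), r₂ x y → r₂ (g • x) (g • y))
    (hp₁ : r₁.HasPairClasses) (hp₂ : r₂.HasPairClasses) (htop : r₁ ⊔ r₂ = ⊤) {a : A}
    (hfree : ∀ g : G, g • a = a → g = 1) {s u : G} (hs : r₁ a (s • a)) (hsa : s • a ≠ a)
    (hu : r₂ a (u • a)) (hua : u • a ≠ a) : Subgroup.closure {s, u} = ⊤ := by
  set K := Subgroup.closure {s, u}
  have step : ∀ r : Setoid A, (∀ (g : G) (x y : A), r x y → r (g • x) (g • y)) →
      r.HasPairClasses → ∀ v ∈ K, r a (v • a) → v • a ≠ a → ∀ x y, r x y →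
      (∃ k ∈ K, k • a = x) → ∃ k ∈ K, k • a = y := by
    rintro r hr hp v hvK hv hva _ y hxy ⟨k, hk, rfl⟩
    by_cases hy : y = k • a
    · exact ⟨k, hk, hy.symm⟩
    · refine ⟨k * v, mul_mem hk hvK, ?_⟩
      rw [mul_smul]
      exact hp (k • a) _ _ (hr k _ _ hv) hxy (fun h => hva (smul_left_cancel k h)) hy
  refine (Subgroup.eq_top_iff' K).2 fun g => ?_
  obtain ⟨k, hk, hkg⟩ := Setoid.forall_of_sup_eq_top htop
    (step r₁ hr₁ hp₁ s (Subgroup.subset_closure (by simp)) hs hsa)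
    (step r₂ hr₂ hp₂ u (Subgroup.subset_closure (by simp)) hu hua)
    (a := a) ⟨1, one_mem K, one_smul G a⟩ (g • a)
  have h := hfree (k⁻¹ * g) (by rw [mul_smul, ← hkg, inv_smul_smul])
  rwa [← inv_mul_eq_one.1 h]

/-- Congruences of a regular action, pairwise meeting in `⊥` and joining to `⊤`, number at most
one more than the elements outside any proper normal subgroup. -/
theorem ncard_congruences_le [Finite G] [IsPretransitive G A] (R : Subgroup G) [R.Normal]
    (hR : R ≠ ⊤) {a : A} (hfree : ∀ g : G, g • a = a → g = 1) {S : Set (Setoid A)}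
    (hfin : S.Finite) (hS : ∀ r ∈ S, ∀ (g : G) (x y : A), r x y → r (g • x) (g • y))
    (hpair : ∀ r ∈ S, ∀ r' ∈ S, r ≠ r' → r ⊓ r' = ⊥ ∧ r ⊔ r' = ⊤) :
    S.ncard ≤ (R : Set G)ᶜ.ncard + 1 := by
  let T : Set (Setoid A) := {r ∈ S | ∃ g : G, g ∉ R ∧ r a (g • a)}
  have hT : T.ncard ≤ (R : Set G)ᶜ.ncard := by
    choose! f hfR hf using fun (r : Setoid A) (hr : r ∈ T) => hr.2
    refine Set.ncard_le_ncard_of_injOn f hfR (fun r hr r' hr' heq => ?_)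
    by_contra hne
    have hbot : (r ⊓ r') a (f r • a) := ⟨hf r hr, heq ▸ hf r' hr'⟩
    rw [(hpair r hr.1 r' hr'.1 hne).1] at hbot
    exact hfR r hr (hfree _ (Eq.symm hbot) ▸ one_mem R)
  have hle : ∀ r ∈ S \ T, r ≤ orbitRel R A := by
    rintro r ⟨hrS, hrT⟩ x y hxy
    obtain ⟨g, rfl⟩ := exists_smul_eq G a x
    obtain ⟨h, rfl⟩ := exists_smul_eq G (g • a) y
    have hmem : g⁻¹ * h * g ∈ R := by
      by_contra hn
      refine hrT ⟨hrS, _, hn, ?_⟩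
      simpa [mul_smul] using hS r hrS g⁻¹ _ _ hxy
    have hh : h ∈ R := by
      simpa [mul_assoc] using Subgroup.Normal.conj_mem ‹_› _ hmem g
    exact (orbitRel R A).symm ⟨⟨h, hh⟩, rfl⟩
  have hdiff : (S \ T).ncard ≤ 1 := by
    refine (Set.ncard_le_one (hfin.subset Set.sdiff_subset)).2 fun r hr r' hr' => ?_
    by_contra hne
    have htop := sup_le (hle r hr) (hle r' hr')
    rw [(hpair r hr.1 r' hr'.1 hne).2] at htop
    refine hR ((Subgroup.eq_top_iff' R).2 fun g => ?_)
    obtain ⟨k, hk⟩ := htop (x := g • a) (y := a) trivial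
    have hkg : (k : G) • a = g • a := hk
    have h := hfree (g⁻¹ * k) (by rw [mul_smul, hkg, inv_smul_smul])
    rw [inv_mul_eq_one.1 h]
    exact k.2
  have := Set.ncard_le_ncard_sdiff_add_ncard S T (hfin.subset fun r hr => hr.1)
  omega

end Action

/-- The homomorphism from a dihedral group sending the generating rotation to `t` and a reflection
to `s`. -/
def DihedralGroup.homOfInvolution {G : Type*} [Group G] {n : ℕ} (t s : G) (ht : t ^ n = 1)
    (hs : s * s = 1) (hts : t * s = s * t⁻¹) : DihedralGroup n →* G :=
  let f : ZMod n →+ Additive G := ZMod.lift n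
    ⟨zmultiplesHom (Additive G) (Additive.ofMul t), by simp [← ofMul_pow, ht]⟩
  have hf : ∀ i, (f i).toMul * s = s * (f (-i)).toMul := by
    intro i
    obtain ⟨k, rfl⟩ := ZMod.intCast_surjective i
    have hk : SemiconjBy s (t⁻¹ ^ k) (t ^ k) := SemiconjBy.zpow_right hts.symm k
    rw [← Int.cast_neg]
    simpa [f] using hk.eq.symm
  MonoidHom.mk'
    (fun
      | .r i => (f i).toMul
      | .sr i => s * (f i).toMul)
    (by
      rintro (i | i) (j | j)
      · simp
      · simp only [r_mul_sr, ← mul_assoc, hf]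
        rw [mul_assoc, ← toMul_add, ← map_add, neg_add_eq_sub]
      · simp [mul_assoc]
      · simp only [sr_mul_sr]
        rw [mul_assoc, ← mul_assoc _ s, hf, mul_assoc s, ← mul_assoc s, hs, one_mul, ← toMul_add,
          ← map_add, neg_add_eq_sub])

theorem DihedralGroup.homOfInvolution_r_one {G : Type*} [Group G] {n : ℕ} (t s : G)
    (ht : t ^ n = 1) (hs : s * s = 1) (hts : t * s = s * t⁻¹) :
    homOfInvolution t s ht hs hts (r 1) = t := by
  have h := ZMod.lift_coe n
    ⟨zmultiplesHom (Additive G) (Additive.ofMul t), by simp [← ofMul_pow, ht]⟩ 1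
  rw [Int.cast_one] at h
  simp [homOfInvolution, h]

theorem zpowers_mul_ne_top {G : Type*} [Group G] {s u : G} (hs : s * s = 1) (hu : u * u = 1)
    (hs1 : s ≠ 1) (hu1 : u ≠ 1) : Subgroup.zpowers (s * u) ≠ ⊤ := by
  intro h
  obtain ⟨i, hi⟩ := Subgroup.mem_zpowers_iff.1 (h ▸ Subgroup.mem_top s)
  have hcomm : Commute (s * u) s := by
    conv_rhs => rw [← hi]
    exact (Commute.refl _).zpow_right i
  have hsq : (s * u) ^ 2 = 1 := by
    rw [pow_two, ← mul_assoc, hcomm.eq, ← mul_assoc, hs, one_mul, hu]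
  have hdvd : (s * u) ^ (2 : ℤ) = 1 := by exact_mod_cast hsq
  rcases Int.even_or_odd' i with ⟨k, rfl | rfl⟩
  · rw [zpow_mul, hdvd, one_zpow] at hi
    exact hs1 hi.symm
  · rw [zpow_add, zpow_mul, hdvd, one_zpow, one_mul, zpow_one] at hi
    exact hu1 (mul_eq_left.1 hi)

/-- A finite group generated by two involutions is dihedral. -/
theorem nonempty_mulEquiv_dihedralGroup {G : Type*} [Group G] [Finite G] {s u : G}
    (hs : s * s = 1) (hu : u * u = 1) (hs1 : s ≠ 1) (hu1 : u ≠ 1)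
    (hgen : Subgroup.closure {s, u} = ⊤) :
    Nonempty (G ≃* DihedralGroup (orderOf (s * u))) := by
  have hn : 0 < orderOf (s * u) := orderOf_pos _
  have : NeZero (orderOf (s * u)) := ⟨hn.ne'⟩
  have hsinv : s⁻¹ = s := inv_eq_of_mul_eq_one_right hs
  have huinv : u⁻¹ = u := inv_eq_of_mul_eq_one_right hu
  let φ : DihedralGroup (orderOf (s * u)) →* G :=
    DihedralGroup.homOfInvolution (s * u) s (pow_orderOf_eq_one _) hs
      (by rw [mul_inv_rev, hsinv, huinv, mul_assoc])
  have hφs : φ (.sr 0) = s := by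
    simp [φ, DihedralGroup.homOfInvolution]
  have hφt : φ (.r 1) = s * u := DihedralGroup.homOfInvolution_r_one _ _ _ _ _
  have hsurj : Function.Surjective φ := by
    rw [← MonoidHom.range_eq_top, eq_top_iff, ← hgen, Subgroup.closure_le]
    rintro x (rfl | rfl)
    · exact ⟨_, hφs⟩
    · exact ⟨.sr 0 * .r 1, by rw [map_mul, hφs, hφt, ← mul_assoc, hs, one_mul]⟩
  have hle := Nat.card_le_card_of_surjective φ hsurj
  rw [DihedralGroup.nat_card] at hle
  have hcard : Nat.card G = 2 * orderOf (s * u) := by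
    obtain ⟨k, hk⟩ := Subgroup.card_subgroup_dvd_card (Subgroup.zpowers (s * u))
    have hne : Nat.card (Subgroup.zpowers (s * u)) ≠ Nat.card G := fun h =>
      zpowers_mul_ne_top hs hu hs1 hu1 (Subgroup.eq_top_of_card_eq _ h)
    rw [Nat.card_zpowers] at hk hne
    have hk2 : k ≤ 2 := by
      by_contra! hk2
      nlinarith
    have hG : 0 < Nat.card G := Nat.card_pos
    interval_cases k <;> omega
  have hbij : Function.Bijective φ :=
    (Nat.bijective_iff_surjective_and_card φ).2 ⟨hsurj, by rw [DihedralGroup.nat_card, hcard]⟩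
  exact ⟨(MulEquiv.ofBijective φ hbij).symm⟩

/-- Let `p` be a prime and let the finite group `G` act faithfully and transitively on the
finite set `A`. If the congruence lattice of the `G`-set `A` is isomorphic to `M_{p+1}`
(the set of congruences strictly between `⊥` and `⊤` has exactly `p + 1` elements, any
two distinct ones meeting in `⊥` and joining to `⊤` among setoids), and `|A| < 2(p+1)`,
then `G ≅ D_{2p}`, `|A| = 2p`, and the action is regular (all stabilizers trivial). -/
theorem stmt_8 {G A : Type*} [Group G] [Fintype G] [Fintype A] [MulAction G A]
    [FaithfulSMul G A] [MulAction.IsPretransitive G A] (p : ℕ) (hp : p.Prime)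
    (hcard : {r : Setoid A | (∀ (g : G) (x y : A), r x y → r (g • x) (g • y)) ∧
        ⊥ < r ∧ r < ⊤}.ncard = p + 1)
    (hMn : ∀ r r' : Setoid A,
      r ∈ {r : Setoid A | (∀ (g : G) (x y : A), r x y → r (g • x) (g • y)) ∧
        ⊥ < r ∧ r < ⊤} →
      r' ∈ {r : Setoid A | (∀ (g : G) (x y : A), r x y → r (g • x) (g • y)) ∧
        ⊥ < r ∧ r < ⊤} →
      r ≠ r' → r ⊓ r' = ⊥ ∧ r ⊔ r' = ⊤)
    (hA : Fintype.card A < 2 * (p + 1)) :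
    Nonempty (G ≃* DihedralGroup p) ∧ Fintype.card A = 2 * p ∧
      ∀ a : A, MulAction.stabilizer G a = ⊥ := by
  classical
  set S : Set (Setoid A) := {r : Setoid A | (∀ (g : G) (x y : A), r x y → r (g • x) (g • y)) ∧
    ⊥ < r ∧ r < ⊤}
  have hSfin : S.Finite := Set.finite_of_ncard_ne_zero (by omega)
  have hA0 : Nonempty A := by
    by_contra hempty
    rw [not_nonempty_iff] at hempty
    obtain ⟨r, hr⟩ := Set.nonempty_of_ncard_ne_zero (s := S) (by omega)
    exact hr.2.1.ne (Setoid.ext fun x => hempty.elim x)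
  obtain ⟨a⟩ := hA0
  obtain ⟨r₁, h₁, r₂, h₂, hne, hc₁, hc₂⟩ := Finset.exists_ne_card_eq_one
    (S := hSfin.toFinset) (f := fun r : Setoid A => Finset.univ.filter fun x => r a x ∧ x ≠ a)
    (T := Finset.univ.erase a)
    (by
      intro r hr r' hr' hne
      refine Finset.disjoint_left.2 fun x hx hx' => ?_
      simp only [Finset.mem_filter, Finset.mem_univ, true_and] at hx hx'
      have hbot : (r ⊓ r') a x := ⟨hx.1, hx'.1⟩
      rw [(hMn r r' (hSfin.mem_toFinset.1 hr) (hSfin.mem_toFinset.1 hr') hne).1] at hbot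
      exact hx.2 (Eq.symm hbot))
    (by
      intro r hr
      have hrS := hSfin.mem_toFinset.1 hr
      obtain ⟨x, hx⟩ := Setoid.exists_ne_of_bot_lt hrS.1 hrS.2.1 a
      exact ⟨x, by simpa using hx⟩)
    (by
      intro r _ x hx
      simp only [Finset.mem_filter, Finset.mem_univ, true_and] at hx
      simpa using hx.2)
    (by
      rw [Finset.card_erase_of_mem (Finset.mem_univ a), Finset.card_univ,
        ← Set.ncard_eq_toFinset_card S hSfin, hcard]
      omega)
  rw [hSfin.mem_toFinset] at h₁ h₂
  have pair : ∀ r ∈ S, (Finset.univ.filter fun x => r a x ∧ x ≠ a).card = 1 →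
      r.HasPairClasses ∧ ∃ s : G, r a (s • a) ∧ s • a ≠ a := by
    intro r hr hc
    obtain ⟨b, hb⟩ := Finset.card_eq_one.1 hc
    simp only [Finset.ext_iff, Finset.mem_filter, Finset.mem_univ, true_and,
      Finset.mem_singleton] at hb
    obtain ⟨s, rfl⟩ := exists_smul_eq G a b
    exact ⟨Setoid.hasPairClasses_of_smul hr.1 fun x hx hxa => (hb x).1 ⟨hx, hxa⟩,
      s, (hb _).2 rfl⟩
  obtain ⟨hp₁, s, hs, hsa⟩ := pair r₁ h₁ hc₁
  obtain ⟨hp₂, u, hu, hua⟩ := pair r₂ h₂ hc₂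
  have htop := (hMn r₁ r₂ h₁ h₂ hne).2
  have hfree : ∀ (b : A) (g : G), g • b = b → g = 1 := fun b g =>
    eq_one_of_smul_eq_of_hasPairClasses h₁.1 h₂.1 hp₁ hp₂ htop
  have hss := mul_self_eq_one_of_hasPairClasses h₁.1 hp₁ (hfree a) hs hsa
  have huu := mul_self_eq_one_of_hasPairClasses h₂.1 hp₂ (hfree a) hu hua
  have hs1 : s ≠ 1 := fun h => hsa (by rw [h, one_smul])
  have hu1 : u ≠ 1 := fun h => hua (by rw [h, one_smul])
  obtain ⟨e⟩ := nonempty_mulEquiv_dihedralGroup hss huu hs1 hu1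
    (closure_pair_eq_top_of_hasPairClasses h₁.1 h₂.1 hp₁ hp₂ htop (hfree a) hs hsa hu hua)
  have hcardG : Nat.card G = 2 * orderOf (s * u) := by
    rw [Nat.card_congr e.toEquiv, DihedralGroup.nat_card]
  have hcardA : Fintype.card A = Nat.card G := by
    rw [← Nat.card_eq_fintype_card]
    refine (Nat.card_congr (Equiv.ofBijective (fun g : G => g • a) ⟨fun g h hgh => ?_,
      exists_smul_eq G a⟩)).symm
    exact (inv_mul_eq_one.1 (hfree a (h⁻¹ * g) (by
      rw [mul_smul, show g • a = h • a from hgh, inv_smul_smul]))).symm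
  have hpos : 0 < orderOf (s * u) := orderOf_pos _
  have hcardR : Nat.card (Subgroup.zpowers (s * u)) = orderOf (s * u) := Nat.card_zpowers _
  have hindex : (Subgroup.zpowers (s * u)).index = 2 := by
    have := (Subgroup.zpowers (s * u)).card_mul_index
    rw [hcardR, hcardG, mul_comm 2] at this
    exact Nat.eq_of_mul_eq_mul_left hpos this
  have : (Subgroup.zpowers (s * u)).Normal := Subgroup.normal_of_index_eq_two hindex
  have hbound := ncard_congruences_le (Subgroup.zpowers (s * u))
    (zpowers_mul_ne_top hss huu hs1 hu1) (hfree a) hSfin (fun r hr => hr.1)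
    (fun r hr r' hr' => hMn r r' hr hr')
  have hcompl := Set.ncard_add_ncard_compl (Subgroup.zpowers (s * u) : Set G)
  have hncardR : (Subgroup.zpowers (s * u) : Set G).ncard = orderOf (s * u) := hcardR
  have horder : orderOf (s * u) = p := by omega
  rw [horder] at e hcardG
  exact ⟨⟨e⟩, hcardA.trans hcardG, fun b => (Subgroup.eq_bot_iff_forall _).2 fun g hg =>
    hfree b g (mem_stabilizer_iff.1 hg)⟩
end

section
/- Let p be an odd prime, let A be a finite nonempty set, and let F be any set of functions from A to A. Suppose the lattice of F-invariant equivalence relations on A is isomorphic to M_{p+1}: the set of F-invariant setoids r with ⊥ < r < ⊤ has exactly p + 1 elements, and any two distinct such setoids r, r' satisfy r ⊓ r' = ⊥ and r ⊔ r' = ⊤ in the lattice of setoids on A. Then |A| ≥ 2p. -/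
/-- `f` preserves every equivalence relation in `S`. -/
def PreservesAll {A : Type*} (S : Set (Setoid A)) (f : A → A) : Prop :=
  ∀ r ∈ S, ∀ x y, r x y → r (f x) (f y)

/-- The equivalence relations in `S`, together with `⊥` and `⊤`, are exactly those invariant
under some set of unary operations, and they form a lattice of height two. -/
structure IsHeightTwoCongruences {A : Type*} (S : Set (Setoid A)) : Prop where
  ne_bot : ∀ r ∈ S, r ≠ ⊥
  ne_top : ∀ r ∈ S, r ≠ ⊤
  eq_of_rel : ∀ r ∈ S, ∀ s ∈ S, r ≠ s → ∀ x y, r x y → s x y → x = y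
  sup_eq_top : ∀ r ∈ S, ∀ s ∈ S, r ≠ s → r ⊔ s = ⊤
  closed : ∀ r : Setoid A, (∀ f, PreservesAll S f → ∀ x y, r x y → r (f x) (f y)) →
    r = ⊥ ∨ r = ⊤ ∨ r ∈ S

section General

variable {A : Type*} {S : Set (Setoid A)}

theorem PreservesAll.comp {f g : A → A} (hf : PreservesAll S f) (hg : PreservesAll S g) :
    PreservesAll S (f ∘ g) :=
  fun r hr x y h => hf r hr _ _ (hg r hr x y h)

theorem PreservesAll.iterate {f : A → A} (hf : PreservesAll S f) (n : ℕ) :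
    PreservesAll S f^[n] := by
  induction n with
  | zero => exact fun r _ x y h => h
  | succ n ih => exact ih.comp hf

theorem IsHeightTwoCongruences.rel_of_le (hS : IsHeightTwoCongruences S) {r s E : Setoid A}
    (hr : r ∈ S) (hs : s ∈ S) (hne : r ≠ s) (hrE : ∀ x y, r x y → E x y)
    (hsE : ∀ x y, s x y → E x y) (x y : A) : E x y := by
  have h : r ⊔ s ≤ E := sup_le (fun x y => hrE x y) (fun x y => hsE x y)
  rw [hS.sup_eq_top r hr s hs hne] at h
  exact h trivial

theorem exists_rel_ne_of_ne_bot {r : Setoid A} (h : r ≠ ⊥) : ∃ x y, r x y ∧ x ≠ y := by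
  by_contra! H
  exact h (le_bot_iff.1 fun x y hxy => H x y hxy)

theorem eq_top_of_forall_rel {r : Setoid A} (h : ∀ x y, r x y) : r = ⊤ :=
  top_le_iff.1 fun x y _ => h x y

theorem Set.exists_two_ne_of_three_le_ncard {α : Type*} {T : Set α} (h : 3 ≤ T.ncard) (r : α) :
    ∃ s ∈ T, ∃ t ∈ T, s ≠ r ∧ t ≠ r ∧ s ≠ t := by
  have hfin : T.Finite := Set.finite_of_ncard_pos (by omega)
  have h2 : 1 < (T \ {r}).ncard := by
    have := Set.le_ncard_sdiff {r} T (by simp)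
    rw [Set.ncard_singleton] at this
    omega
  obtain ⟨s, t, hs, ht, hst⟩ := (Set.one_lt_ncard_iff (hfin.subset Set.sdiff_subset)).1 h2
  exact ⟨s, hs.1, t, ht.1, hs.2, ht.2, hst⟩

end General

section Retract

variable {A : Type*} {S : Set (Setoid A)} {e : A → A}

theorem IsHeightTwoCongruences.not_forall_rel_retract (hS : IsHeightTwoCongruences S)
    (hcard : 3 ≤ S.ncard) (he : PreservesAll S e) (hne : ∃ x y, e x ≠ e y)
    {r : Setoid A} (hr : r ∈ S) : ∃ x y, ¬ r (e x) (e y) := by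
  by_contra! H
  obtain ⟨s, hs, t, ht, hsr, htr, hst⟩ := Set.exists_two_ne_of_three_le_ncard hcard r
  obtain ⟨x, y, hxy⟩ := hne
  exact hxy (hS.rel_of_le (E := Setoid.ker e) hs ht hst
    (fun a b h => hS.eq_of_rel s hs r hr hsr _ _ (he s hs _ _ h) (H a b))
    (fun a b h => hS.eq_of_rel t ht r hr htr _ _ (he t ht _ _ h) (H a b)) x y)

theorem IsHeightTwoCongruences.exists_rel_retract_ne (hS : IsHeightTwoCongruences S)
    (hcard : 3 ≤ S.ncard) (he : PreservesAll S e) (hne : ∃ x y, e x ≠ e y)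
    {r : Setoid A} (hr : r ∈ S) : ∃ x y, r x y ∧ e x ≠ e y := by
  by_contra! H
  obtain ⟨s, hs, -, -, hsr, -, -⟩ := Set.exists_two_ne_of_three_le_ncard hcard r
  obtain ⟨x, y, hxy⟩ := hS.not_forall_rel_retract hcard he hne hs
  refine hxy (hS.rel_of_le (E := Setoid.comap e s) hs hr hsr (fun a b h => he s hs _ _ h)
    (fun a b h => ?_) x y)
  rw [Setoid.comap_rel, H a b h]

theorem IsHeightTwoCongruences.comap_fixed_ne_bot (hS : IsHeightTwoCongruences S)
    (hcard : 3 ≤ S.ncard) (he : PreservesAll S e) (hidem : ∀ x, e (e x) = e x)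
    (hne : ∃ x y, e x ≠ e y) {r : Setoid A} (hr : r ∈ S) :
    r.comap (Subtype.val : {x // e x = x} → A) ≠ ⊥ := by
  intro h
  obtain ⟨x, y, hxy, hexy⟩ := hS.exists_rel_retract_ne hcard he hne hr
  have h' : (r.comap (Subtype.val : {x // e x = x} → A)) ⟨e x, hidem x⟩ ⟨e y, hidem y⟩ :=
    he r hr x y hxy
  rw [h] at h'
  exact hexy (congrArg Subtype.val h')

theorem IsHeightTwoCongruences.injOn_comap_fixed (hS : IsHeightTwoCongruences S)
    (hcard : 3 ≤ S.ncard) (he : PreservesAll S e) (hidem : ∀ x, e (e x) = e x)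
    (hne : ∃ x y, e x ≠ e y) :
    Set.InjOn (Setoid.comap (Subtype.val : {x // e x = x} → A)) S := by
  intro r hr s hs h
  by_contra hrs
  refine hS.comap_fixed_ne_bot hcard he hidem hne hr (le_bot_iff.1 fun x y hxy => ?_)
  have hxy' : s.comap (Subtype.val : {x // e x = x} → A) x y := by
    rw [← h]
    exact hxy
  exact Subtype.ext (hS.eq_of_rel r hr s hs hrs _ _ hxy hxy')

/-- Restricting to the image of a nonconstant idempotent operation keeps the congruence lattice. -/
theorem IsHeightTwoCongruences.retract (hS : IsHeightTwoCongruences S)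
    (hcard : 3 ≤ S.ncard) (he : PreservesAll S e) (hidem : ∀ x, e (e x) = e x)
    (hne : ∃ x y, e x ≠ e y) :
    IsHeightTwoCongruences (Setoid.comap (Subtype.val : {x // e x = x} → A) '' S) where
  ne_bot := by
    rintro _ ⟨r, hr, rfl⟩
    exact hS.comap_fixed_ne_bot hcard he hidem hne hr
  ne_top := by
    rintro _ ⟨r, hr, rfl⟩ h
    obtain ⟨x, y, hxy⟩ := hS.not_forall_rel_retract hcard he hne hr
    have h' : (r.comap (Subtype.val : {x // e x = x} → A)) ⟨e x, hidem x⟩ ⟨e y, hidem y⟩ := by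
      rw [h]
      trivial
    exact hxy h'
  eq_of_rel := by
    rintro _ ⟨r, hr, rfl⟩ _ ⟨s, hs, rfl⟩ hrs x y hr' hs'
    exact Subtype.ext (hS.eq_of_rel r hr s hs (fun h => hrs (by rw [h])) _ _ hr' hs')
  sup_eq_top := by
    rintro _ ⟨r, hr, rfl⟩ _ ⟨s, hs, rfl⟩ hrs
    refine eq_top_of_forall_rel fun x y => ?_
    set E := r.comap (Subtype.val : {x // e x = x} → A) ⊔ s.comap Subtype.val
    have key := hS.rel_of_le (E := E.comap fun a => ⟨e a, hidem a⟩) hr hs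
      (fun h => hrs (by rw [h]))
      (fun a b h => (le_sup_left : _ ≤ E) (he r hr _ _ h))
      (fun a b h => (le_sup_right : _ ≤ E) (he s hs _ _ h)) x y
    rw [Setoid.comap_rel] at key
    simpa only [x.2, y.2, Subtype.coe_eta] using key
  closed := by
    intro ρ hρ
    let q : A → {x // e x = x} := fun a => ⟨e a, hidem a⟩
    have hq : ∀ u : {x // e x = x}, q u = u := fun u => Subtype.ext u.2
    let θ : Setoid A :=
      { r := fun x y => ∀ g, PreservesAll S g → ρ (q (g x)) (q (g y))
        iseqv := ⟨fun x g _ => ρ.refl _, fun h g hg => ρ.symm (h g hg),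
          fun h h' g hg => ρ.trans (h g hg) (h' g hg)⟩ }
    have hθρ : θ.comap Subtype.val = ρ := by
      ext u v
      constructor
      · intro h
        have h' : ρ (q u) (q v) := h id fun r _ x y h => h
        rwa [hq, hq] at h'
      · intro h g hg
        refine hρ (fun w => q (g w)) ?_ u v h
        rintro _ ⟨r, hr, rfl⟩ x y hxy
        exact he r hr _ _ (hg r hr _ _ hxy)
    rcases hS.closed θ (fun f hf x y h g hg => h (g ∘ f) (hg.comp hf)) with h | h | h
    · left
      rw [← hθρ, h]
      exact le_bot_iff.1 fun x y hxy => Subtype.ext hxy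
    · right; left
      rw [← hθρ, h]
      rfl
    · exact Or.inr (Or.inr ⟨θ, h, hθρ⟩)

/-- A nonconstant operation composes with itself nontrivially through some operation. -/
theorem IsHeightTwoCongruences.exists_comp_ne (hS : IsHeightTwoCongruences S)
    (hcard : 3 ≤ S.ncard) {f : A → A} (hf : PreservesAll S f) (hne : ∃ x y, f x ≠ f y) :
    ∃ g, PreservesAll S g ∧ ∃ x y, f (g (f x)) ≠ f (g (f y)) := by
  by_contra! H
  let θ : Setoid A :=
    { r := fun x y => ∀ g, PreservesAll S g → f (g x) = f (g y)
      iseqv := ⟨fun x g _ => rfl, fun h g hg => (h g hg).symm,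
        fun h h' g hg => (h g hg).trans (h' g hg)⟩ }
  have hθf : ∀ x y, θ x y → f x = f y := fun x y h => h id fun r _ x y h => h
  have hfθ : ∀ x y, θ (f x) (f y) := fun x y g hg => H g hg x y
  obtain ⟨x, y, hxy⟩ := hne
  rcases hS.closed θ (fun k hk x y h g hg => h (g ∘ k) (hg.comp hk)) with h | h | h
  · have := hfθ x y
    rw [h] at this
    exact hxy this
  · exact hxy (hθf x y (by rw [h]; trivial))
  · obtain ⟨s, hs, -, -, hsθ, -, -⟩ := Set.exists_two_ne_of_three_le_ncard hcard θ
    exact hxy (hS.rel_of_le (E := Setoid.ker f) h hs hsθ.symm hθf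
      (fun a b hab => hS.eq_of_rel s hs θ h hsθ _ _ (hf s hs _ _ hab) (hfθ a b)) x y)

theorem exists_iterate_eq_self_of_image_eq [Finite A] {h : A → A} {U : Set A}
    (hU : h '' U = U) : ∃ n, ∀ u ∈ U, h^[n + 1] u = u := by
  have hmaps : Set.MapsTo h U U := Set.mapsTo_iff_image_subset.2 hU.le
  have hsurj : Function.Surjective hmaps.restrict := by
    rintro ⟨u, hu⟩
    obtain ⟨v, hv, rfl⟩ := hU.ge hu
    exact ⟨⟨v, hv⟩, rfl⟩
  let σ : Equiv.Perm U := Equiv.ofBijective _ (Finite.injective_iff_bijective.1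
    (Finite.injective_iff_surjective.2 hsurj))
  have hiter : ∀ n (u : U), ((σ ^ n) u : A) = h^[n] u := by
    intro n
    induction n with
    | zero => intro u; rfl
    | succ n ih =>
      intro u
      rw [pow_succ, Equiv.Perm.mul_apply, ih, Function.iterate_succ_apply]
      rfl
  have hpos : 0 < orderOf σ := orderOf_pos σ
  refine ⟨orderOf σ - 1, fun u hu => ?_⟩
  rw [Nat.sub_add_cancel hpos, ← hiter _ ⟨u, hu⟩, pow_orderOf_eq_one]
  rfl

theorem IsHeightTwoCongruences.exists_idempotent [Finite A] (hS : IsHeightTwoCongruences S)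
    (hcard : 3 ≤ S.ncard) {f : A → A} (hf : PreservesAll S f) (hne : ∃ x y, f x ≠ f y)
    (hbij : ¬ Function.Bijective f) :
    ∃ e, PreservesAll S e ∧ (∀ x, e (e x) = e x) ∧ (∃ x y, e x ≠ e y) ∧ ∃ x, e x ≠ x := by
  let T : Set (A → A) := {f | PreservesAll S f ∧ ∃ x y, f x ≠ f y}
  obtain ⟨m, ⟨hm, hmne⟩, hmin⟩ :=
    T.toFinite.exists_minimalFor (fun f => (Set.range f).ncard) T ⟨f, hf, hne⟩
  obtain ⟨g, hg, hgne⟩ := hS.exists_comp_ne hcard hm hmne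
  have hfm : (Set.range m).ncard < Nat.card A := by
    refine (not_lt.1 fun h => ?_ : (Set.range m).ncard ≤ (Set.range f).ncard).trans_lt ?_
    · exact absurd (hmin ⟨hf, hne⟩ h.le) (not_le.2 h)
    · rw [← Set.ncard_univ]
      refine Set.ncard_lt_ncard (Set.ssubset_univ_iff.2 fun h => hbij ?_)
      exact Finite.surjective_iff_bijective.1 (Set.range_eq_univ.1 h)
  have hsub : Set.range (m ∘ g ∘ m) ⊆ Set.range m := Set.range_comp_subset_range _ _
  have hrange : Set.range (m ∘ g ∘ m) = Set.range m :=
    Set.eq_of_subset_of_ncard_le hsub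
      (hmin ⟨hm.comp (hg.comp hm), hgne⟩ (Set.ncard_le_ncard hsub))
  have himage : (m ∘ g) '' Set.range m = Set.range m := by
    rw [← Set.range_comp]
    exact hrange
  obtain ⟨n, hn⟩ := exists_iterate_eq_self_of_image_eq himage
  have hmem : ∀ x, (m ∘ g)^[n + 1] x ∈ Set.range m := fun x => by
    rw [Function.iterate_succ_apply']
    exact ⟨_, rfl⟩
  refine ⟨(m ∘ g)^[n + 1], (hm.comp hg).iterate _, fun x => hn _ (hmem x), ?_, ?_⟩
  · obtain ⟨x, y, hxy⟩ := hmne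
    exact ⟨m x, m y, by rwa [hn _ ⟨x, rfl⟩, hn _ ⟨y, rfl⟩]⟩
  · by_contra! H
    rw [← Set.ncard_univ, ← Set.eq_univ_of_forall fun x => H x ▸ hmem x] at hfm
    exact lt_irrefl _ hfm

end Retract

section Permutational

variable {A : Type*} {S : Set (Setoid A)}

/-- Every operation preserving `S` is constant or a permutation. -/
def IsPermutational (S : Set (Setoid A)) : Prop :=
  ∀ f, PreservesAll S f → (∀ x y, f x = f y) ∨ Function.Bijective f

theorem IsHeightTwoCongruences.closed_of_perm (hS : IsHeightTwoCongruences S)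
    (hperm : IsPermutational S) (r : Setoid A)
    (h : ∀ g : Equiv.Perm A, PreservesAll S g → ∀ x y, r x y → r (g x) (g y)) :
    r = ⊥ ∨ r = ⊤ ∨ r ∈ S := by
  refine hS.closed r fun f hf x y hxy => ?_
  rcases hperm f hf with hconst | hbij
  · rw [hconst x y]
  · exact h (Equiv.ofBijective f hbij) hf x y hxy

theorem PreservesAll.perm_inv [Finite A] {g : Equiv.Perm A} (hg : PreservesAll S g) :
    PreservesAll S (g⁻¹ : Equiv.Perm A) := by
  obtain ⟨n, hn⟩ : g⁻¹ ∈ Submonoid.powers g :=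
    mem_powers_iff_mem_zpowers.2 (inv_mem (Subgroup.mem_zpowers g))
  rw [← hn, Equiv.Perm.coe_pow]
  exact hg.iterate n

/-- The equivalence relation whose classes are `B` and the singletons outside `B`. -/
def collapse (B : Set A) : Setoid A where
  r x y := x = y ∨ x ∈ B ∧ y ∈ B
  iseqv := ⟨fun _ => Or.inl rfl, fun h => h.imp Eq.symm And.symm, by
    rintro x y z (rfl | h) (rfl | h')
    · exact Or.inl rfl
    · exact Or.inr h'
    · exact Or.inr h
    · exact Or.inr ⟨h.1, h'.2⟩⟩

/-- The equivalence relation whose classes are `B` and its complement. -/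
def split (B : Set A) : Setoid A := Setoid.ker (· ∈ B)

theorem IsHeightTwoCongruences.subsingleton_of_invariant (hS : IsHeightTwoCongruences S)
    (hperm : IsPermutational S) {B : Set A}
    (hB : ∀ g : Equiv.Perm A, PreservesAll S g → ∀ x, g x ∈ B ↔ x ∈ B)
    {a b c d : A} (ha : a ∈ B) (hb : b ∈ B) (hab : a ≠ b) (hc : c ∉ B) (hd : d ∉ B) : c = d := by
  by_contra hcd
  have hcollapse : collapse B ∈ S := by
    rcases hS.closed_of_perm hperm (collapse B) (fun g hg x y => by
      rintro (rfl | h)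
      · exact Or.inl rfl
      · exact Or.inr ⟨(hB g hg x).2 h.1, (hB g hg y).2 h.2⟩) with h | h | h
    · exact absurd (h ▸ (Or.inr ⟨ha, hb⟩ : collapse B a b) : (⊥ : Setoid A) a b) hab
    · rcases (h ▸ trivial : collapse B c d) with h | h
      · exact absurd h hcd
      · exact absurd h.1 hc
    · exact h
  have hsplit : split B ∈ S := by
    rcases hS.closed_of_perm hperm (split B) (fun g hg x y h => by
      exact propext ((hB g hg x).trans ((iff_of_eq h).trans (hB g hg y).symm))) with h | h | h
    · have : split B a b := propext (iff_of_true ha hb)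
      rw [h] at this
      exact absurd this hab
    · have : split B a c := by rw [h]; trivial
      exact absurd ((iff_of_eq this).1 ha) hc
    · exact h
  refine hab (hS.eq_of_rel _ hcollapse _ hsplit (fun h => ?_) a b (Or.inr ⟨ha, hb⟩)
    (propext (iff_of_true ha hb)))
  have : collapse B c d := by
    rw [h]
    exact propext (iff_of_false hc hd)
  rcases this with h | h
  · exact hcd h
  · exact hc h.1

theorem IsHeightTwoCongruences.eq_of_fixed (hS : IsHeightTwoCongruences S)
    (hperm : IsPermutational S) (hcard : 4 ≤ S.ncard) {o : A}
    (ho : ∀ g : Equiv.Perm A, PreservesAll S g → g o = o) (x : A) : x = o := by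
  by_contra hxo
  have hΩ := hS.closed_of_perm hperm (split {o}) (fun g hg x y h => by
    have key : ∀ z, g z = o ↔ z = o := fun z => by
      rw [← g.injective.eq_iff (a := z), ho g hg]
    exact propext ((key x).trans ((iff_of_eq h).trans (key y).symm)))
  have hΩtop : split {o} ≠ ⊤ := fun h => by
    have : split {o} x o := by rw [h]; trivial
    exact hxo ((iff_of_eq this).2 rfl)
  have hΩeq : ∀ s ∈ S, s ≠ split {o} → ∀ a b, s a b → a ≠ o → b ≠ o → a = b := by
    intro s hs hne a b hab hao hbo
    have hsplit : split {o} a b := propext (iff_of_false hao hbo)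
    rcases hΩ with h | h | h
    · rw [h] at hsplit
      exact hsplit
    · exact absurd h hΩtop
    · exact hS.eq_of_rel s hs _ h hne _ _ hab hsplit
  have hexists : ∀ s ∈ S, s ≠ split {o} → ∃ z, z ≠ o ∧ s o z ∧
      ∀ g : Equiv.Perm A, PreservesAll S g → g z = z := by
    intro s hs hne
    obtain ⟨z, hzo, hz⟩ : ∃ z, z ≠ o ∧ s o z := by
      obtain ⟨a, b, hab, hne'⟩ := exists_rel_ne_of_ne_bot (hS.ne_bot s hs)
      by_cases hao : a = o
      · subst hao
        exact ⟨b, hne'.symm, hab⟩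
      · by_cases hbo : b = o
        · subst hbo
          exact ⟨a, hao, s.symm hab⟩
        · exact absurd (hΩeq s hs hne a b hab hao hbo) hne'
    refine ⟨z, hzo, hz, fun g hg => hΩeq s hs hne _ _ ?_ ?_ hzo⟩
    · have := hg s hs _ _ hz
      rw [ho g hg] at this
      exact s.trans (s.symm this) hz
    · rw [← ho g hg]
      exact fun h => hzo (g.injective h)
  have hfin : S.Finite := Set.finite_of_ncard_pos (by omega)
  have h3 : 2 < (S \ {split {o}}).ncard := by
    have := Set.le_ncard_sdiff {split {o}} S (by simp)
    rw [Set.ncard_singleton] at this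
    omega
  obtain ⟨s, t, u, hs, ht, hu, hst, hsu, htu⟩ :=
    (Set.two_lt_ncard_iff (hfin.subset Set.sdiff_subset)).1 h3
  obtain ⟨a, hao, hsa, ha⟩ := hexists s hs.1 hs.2
  obtain ⟨b, hbo, htb, hb⟩ := hexists t ht.1 ht.2
  obtain ⟨c, hco, huc, hc⟩ := hexists u hu.1 hu.2
  have hab : b ≠ a := by
    rintro rfl
    exact hao (hS.eq_of_rel s hs.1 t ht.1 hst o b hsa htb).symm
  have hac : c ≠ a := by
    rintro rfl
    exact hao (hS.eq_of_rel s hs.1 u hu.1 hsu o c hsa huc).symm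
  have hbc : b ≠ c := by
    rintro rfl
    exact hbo (hS.eq_of_rel t ht.1 u hu.1 htu o b htb huc).symm
  refine hbc (hS.subsingleton_of_invariant hperm (B := {o, a}) (fun g hg z => ?_)
    (Or.inl rfl) (Or.inr rfl) hao.symm (by simp [hbo, hab]) (by simp [hco, hac]))
  have h1 : g z = o ↔ z = o := by rw [← g.injective.eq_iff (a := z), ho g hg]
  have h2 : g z = a ↔ z = a := by rw [← g.injective.eq_iff (a := z), ha g hg]
  simp [h1, h2]

theorem IsHeightTwoCongruences.exists_perm_apply_eq [Finite A] (hS : IsHeightTwoCongruences S)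
    (hperm : IsPermutational S) (hcard : 4 ≤ S.ncard) (a b : A) :
    ∃ g : Equiv.Perm A, PreservesAll S g ∧ g a = b := by
  by_contra! H
  let B : Set A := {x | ∃ g : Equiv.Perm A, PreservesAll S g ∧ g a = x}
  have hBmem : ∀ g : Equiv.Perm A, PreservesAll S g → ∀ x ∈ B, g x ∈ B := by
    rintro g hg _ ⟨k, hk, rfl⟩
    exact ⟨g * k, hg.comp hk, rfl⟩
  have hB : ∀ g : Equiv.Perm A, PreservesAll S g → ∀ x, g x ∈ B ↔ x ∈ B := by
    refine fun g hg x => ⟨fun h => ?_, hBmem g hg x⟩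
    simpa using hBmem _ hg.perm_inv _ h
  have ha : a ∈ B := ⟨1, fun r _ x y h => h, rfl⟩
  have hb : b ∉ B := fun ⟨g, hg, h⟩ => H g hg h
  have hba : b ≠ a := fun h => hb (h ▸ ha)
  by_cases hsub : ∀ x ∈ B, x = a
  · exact hba (hS.eq_of_fixed hperm hcard (fun g hg => hsub _ (hBmem g hg a ha)) b)
  · push Not at hsub
    obtain ⟨c, hc, hca⟩ := hsub
    refine hba.symm (hS.eq_of_fixed hperm hcard (fun g hg => ?_) a)
    exact hS.subsingleton_of_invariant hperm hB hc ha hca (fun h => hb ((hB g hg b).1 h)) hb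

/-- If one class of `r` has a single nontrivial member, transitivity turns `r` into a perfect
matching, given by a fixed-point-free involution. -/
theorem exists_matching [Finite A]
    (htrans : ∀ a b, ∃ g : Equiv.Perm A, PreservesAll S g ∧ g a = b)
    {r : Setoid A} (hr : r ∈ S) {a b : A} (hba : b ≠ a) (hab : r a b)
    (huniq : ∀ c, r a c → c ≠ a → c = b) :
    ∃ σ : Equiv.Perm A, (∀ x, σ (σ x) = x) ∧ (∀ x, σ x ≠ x) ∧ (∀ x, r x (σ x)) ∧
      (∀ x y, r x y → y = x ∨ y = σ x) ∧
      ∀ g : Equiv.Perm A, PreservesAll S g → ∀ x, g (σ x) = σ (g x) := by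
  have key : ∀ x, ∃ y, y ≠ x ∧ r x y ∧ ∀ z, r x z → z ≠ x → z = y := by
    intro x
    obtain ⟨g, hg, rfl⟩ := htrans a x
    refine ⟨g b, fun h => hba (g.injective h), hg r hr _ _ hab, fun z hz hzx => ?_⟩
    have hz' : r a (g⁻¹ z) := by simpa using hg.perm_inv r hr _ _ hz
    simp [← huniq _ hz' fun h => hzx (by simp [← h])]
  choose s hne hrel hall using key
  have hinv : Function.Involutive s := fun x =>
    (hall (s x) x (r.symm (hrel x)) (hne x).symm).symm
  refine ⟨hinv.toPerm, hinv, hne, hrel, fun x y h => ?_, fun g hg x => ?_⟩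
  · by_cases hyx : y = x
    · exact Or.inl hyx
    · exact Or.inr (hall x y h hyx)
  · exact hall _ _ (hg r hr _ _ (hrel x)) fun h => hne x (g.injective h)

theorem exists_rel_ne_of_transitive
    (htrans : ∀ a b, ∃ g : Equiv.Perm A, PreservesAll S g ∧ g a = b)
    {r : Setoid A} (hr : r ∈ S) (hbot : r ≠ ⊥) (a : A) : ∃ x, r a x ∧ x ≠ a := by
  obtain ⟨x, y, hxy, hne⟩ := exists_rel_ne_of_ne_bot hbot
  obtain ⟨g, hg, rfl⟩ := htrans x a
  exact ⟨g y, hg r hr _ _ hxy, fun h => hne (g.injective h).symm⟩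

/-- Two matchings whose join is everything generate a dihedral group commuting with all the
permutations preserving `S`; the orbits of its rotations give an index-two congruence. -/
theorem IsHeightTwoCongruences.two_mul_le_card_of_matchings [Finite A]
    (hS : IsHeightTwoCongruences S) (hperm : IsPermutational S)
    (htrans : ∀ a b, ∃ g : Equiv.Perm A, PreservesAll S g ∧ g a = b) (a : A)
    {r s : Setoid A} (hr : r ∈ S) (hs : s ∈ S) (hrs : r ≠ s) {σ τ : Equiv.Perm A}
    (hσσ : ∀ x, σ (σ x) = x) (hττ : ∀ x, τ (τ x) = x) (hσne : ∀ x, σ x ≠ x)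
    (hτne : ∀ x, τ x ≠ x) (hrσ : ∀ x, r x (σ x)) (hsτ : ∀ x, s x (τ x))
    (hr' : ∀ x y, r x y → y = x ∨ y = σ x) (hs' : ∀ x y, s x y → y = x ∨ y = τ x)
    (hσ : ∀ g : Equiv.Perm A, PreservesAll S g → ∀ x, g (σ x) = σ (g x))
    (hτ : ∀ g : Equiv.Perm A, PreservesAll S g → ∀ x, g (τ x) = τ (g x)) :
    2 * (S.ncard - 1) ≤ Nat.card A := by
  set ρ : Equiv.Perm A := σ * τ with hρ
  have hρapp : ∀ x, ρ x = σ (τ x) := fun _ => rfl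
  have hcomm : ∀ g : Equiv.Perm A, PreservesAll S g →
      ∀ (k : ℤ) x, g ((ρ ^ k) x) = (ρ ^ k) (g x) := by
    intro g hg k x
    have h : Commute g ρ := Equiv.ext fun x => by
      simp only [Equiv.Perm.mul_apply, hρ, hσ g hg, hτ g hg]
    exact Equiv.congr_fun (h.zpow_right k) x
  let R := Equiv.Perm.SameCycle.setoid ρ
  have hR := hS.closed_of_perm hperm R (by
    rintro g hg x _ ⟨k, rfl⟩
    exact ⟨k, (hcomm g hg k x).symm⟩)
  have hRtop : R ≠ ⊤ := by
    intro h
    have hall : ∀ y, Equiv.Perm.SameCycle ρ a y := fun y => by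
      have : R a y := by rw [h]; trivial
      exact this
    obtain ⟨k, hk⟩ := hall (σ a)
    have hkσ : ρ ^ k = σ := Equiv.ext fun x => by
      obtain ⟨g, hg, rfl⟩ := htrans a x
      rw [← hcomm g hg, hk, hσ g hg]
    have hσρ : ∀ x, σ (ρ x) = ρ (σ x) := by
      have : Commute σ ρ := by
        rw [← hkσ]
        exact Commute.zpow_self ρ k
      exact Equiv.congr_fun this
    have hsq : ρ ^ (2 : ℤ) = 1 := Equiv.ext fun x => by
      have h1 := hσρ (τ x)
      rw [hρapp, hρapp, hσσ, hττ] at h1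
      rw [zpow_ofNat, pow_two, Equiv.Perm.mul_apply, hρapp (ρ x), hρapp x, ← h1]
      rfl
    have htwo : ∀ y, y ≠ a → y = ρ a := by
      intro y hy
      obtain ⟨m, rfl⟩ := hall y
      rcases Int.even_or_odd' m with ⟨n, rfl | rfl⟩
      · rw [zpow_mul, hsq, one_zpow] at hy
        exact absurd rfl hy
      · rw [zpow_add, zpow_mul, hsq, one_zpow, one_mul, zpow_one]
    have hστ : σ a = τ a := (htwo _ (hσne a)).trans (htwo _ (hτne a)).symm
    exact hσne a (hS.eq_of_rel r hr s hs hrs _ _ (hrσ a) (hστ ▸ hsτ a)).symm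
  let O : Set A := {y | Equiv.Perm.SameCycle ρ a y}
  have hcover : Oᶜ ⊆ σ '' O := by
    have hstepσ : ∀ x, (σ x ∈ O ∨ σ (σ x) ∈ O) ↔ (x ∈ O ∨ σ x ∈ O) := fun x => by
      rw [hσσ, or_comm]
    have hstepτ : ∀ x, (τ x ∈ O ∨ σ (τ x) ∈ O) ↔ (x ∈ O ∨ σ x ∈ O) := fun x => by
      have h1 : σ (τ x) ∈ O ↔ x ∈ O := Equiv.Perm.sameCycle_apply_right (f := ρ)
      have h2 : σ x ∈ O ↔ τ x ∈ O := by
        have : ρ (τ x) = σ x := by rw [hρapp, hττ]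
        rw [← this]
        exact Equiv.Perm.sameCycle_apply_right
      rw [h1, h2, or_comm]
    intro y hy
    have key := hS.rel_of_le (E := Setoid.ker fun y => y ∈ O ∨ σ y ∈ O) hr hs hrs
      (fun x y h => by
        rcases hr' x y h with rfl | rfl
        · rfl
        · exact (propext (hstepσ x)).symm)
      (fun x y h => by
        rcases hs' x y h with rfl | rfl
        · rfl
        · exact (propext (hstepτ x)).symm) a y
    rcases (iff_of_eq key).1 (Or.inl (Equiv.Perm.SameCycle.refl ρ a)) with h | h
    · exact absurd h hy
    · exact ⟨σ y, h, hσσ y⟩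
  have : Nonempty A := ⟨a⟩
  choose! pt hpt hptne using fun t (ht : t ∈ S) =>
    exists_rel_ne_of_transitive htrans ht (hS.ne_bot t ht) a
  have hpts : (S \ {R}).ncard ≤ Oᶜ.ncard := by
    refine Set.ncard_le_ncard_of_injOn pt (fun t ht hO => hptne t ht.1 ?_) ?_
    · have hRt : R a (pt t) := hO
      rcases hR with h | h | h
      · rw [h] at hRt
        exact hRt.symm
      · exact absurd h hRtop
      · exact (hS.eq_of_rel t ht.1 R h ht.2 _ _ (hpt t ht.1) hRt).symm
    · intro t ht u hu htu
      by_contra hne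
      exact hptne t ht.1 (hS.eq_of_rel t ht.1 u hu.1 hne _ _ (hpt t ht.1)
        (htu ▸ hpt u hu.1)).symm
  have h1 := Set.le_ncard_sdiff {R} S (by simp)
  rw [Set.ncard_singleton] at h1
  have h2 := (Set.ncard_le_ncard hcover).trans (Set.ncard_image_le (Set.toFinite O))
  have h3 := Set.ncard_add_ncard_compl O
  omega

/-- The nontrivial parts of the classes of a point are disjoint, so if `A` is small then two
of them are singletons. -/
theorem IsHeightTwoCongruences.exists_pair_of_card_lt [Finite A] (hS : IsHeightTwoCongruences S)
    (htrans : ∀ a b, ∃ g : Equiv.Perm A, PreservesAll S g ∧ g a = b) (a : A)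
    (hlt : Nat.card A < 2 * (S.ncard - 1)) :
    ∃ r ∈ S, ∃ s ∈ S, r ≠ s ∧ (∃ b, {x | r a x ∧ x ≠ a} = {b}) ∧
      ∃ c, {x | s a x ∧ x ≠ a} = {c} := by
  classical
  have := Fintype.ofFinite A
  have hfin : S.Finite := Set.finite_of_ncard_pos (by omega)
  let T := hfin.toFinset
  have hT : T.card = S.ncard := (Set.ncard_eq_toFinset_card S hfin).symm
  have hmem : ∀ {r}, r ∈ T → r ∈ S := fun h => hfin.mem_toFinset.1 h
  let B : Setoid A → Finset A := fun r => {x | r a x ∧ x ≠ a}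
  have hsum : ∑ r ∈ T, (B r).card ≤ Nat.card A := by
    rw [← Finset.card_biUnion, Nat.card_eq_fintype_card]
    · exact Finset.card_le_univ _
    · intro r hr s hs hrs
      refine Finset.disjoint_left.2 fun x hxr hxs => ?_
      simp only [B, Finset.mem_filter, Finset.mem_univ, true_and] at hxr hxs
      exact hxr.2 (hS.eq_of_rel r (hmem hr) s (hmem hs) hrs _ _ hxr.1 hxs.1).symm
  have hlower : ∑ _r ∈ T, 2 ≤ ∑ r ∈ T, ((B r).card + if (B r).card = 1 then 1 else 0) := by
    refine Finset.sum_le_sum fun r hr => ?_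
    have hpos : 0 < (B r).card := by
      obtain ⟨x, hx⟩ := exists_rel_ne_of_transitive htrans (hmem hr) (hS.ne_bot r (hmem hr)) a
      exact Finset.card_pos.2 ⟨x, by simpa [B] using hx⟩
    split_ifs <;> omega
  rw [Finset.sum_add_distrib, ← Finset.card_filter, Finset.sum_const, smul_eq_mul] at hlower
  obtain ⟨r, hr, s, hs, hrs⟩ := Finset.one_lt_card.1
    (show 1 < (T.filter fun r => (B r).card = 1).card by omega)
  rw [Finset.mem_filter] at hr hs
  have hsingle : ∀ t, (B t).card = 1 → ∃ b, {x | t a x ∧ x ≠ a} = {b} := by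
    intro t ht
    obtain ⟨b, hb⟩ := Finset.card_eq_one.1 ht
    exact ⟨b, by simpa [B] using congrArg (fun U : Finset A => (U : Set A)) hb⟩
  exact ⟨r, hmem hr.1, s, hmem hs.1, hrs, hsingle r hr.2, hsingle s hs.2⟩

theorem IsHeightTwoCongruences.two_mul_le_card_of_isPermutational [Finite A] [Nonempty A]
    (hS : IsHeightTwoCongruences S) (hperm : IsPermutational S) (hcard : 4 ≤ S.ncard) :
    2 * (S.ncard - 1) ≤ Nat.card A := by
  by_contra! hlt
  obtain ⟨a⟩ := ‹Nonempty A›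
  have htrans := hS.exists_perm_apply_eq hperm hcard
  obtain ⟨r, hr, s, hs, hrs, ⟨b, hb⟩, c, hc⟩ := hS.exists_pair_of_card_lt htrans a hlt
  have hb' : r a b ∧ b ≠ a := hb.ge rfl
  have hc' : s a c ∧ c ≠ a := hc.ge rfl
  obtain ⟨σ, hσσ, hσne, hrσ, hr', hσ⟩ :=
    exists_matching htrans hr hb'.2 hb'.1 fun d h hd => hb.le ⟨h, hd⟩
  obtain ⟨τ, hττ, hτne, hsτ, hs', hτ⟩ :=
    exists_matching htrans hs hc'.2 hc'.1 fun d h hd => hc.le ⟨h, hd⟩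
  exact absurd (hS.two_mul_le_card_of_matchings hperm htrans a hr hs hrs hσσ hττ hσne hτne
    hrσ hsτ hr' hs' hσ hτ) (not_le.2 hlt)

end Permutational

theorem IsHeightTwoCongruences.two_mul_le_card (n : ℕ) :
    ∀ {A : Type*} [Finite A] [Nonempty A] {S : Set (Setoid A)}, Nat.card A = n →
      IsHeightTwoCongruences S → 4 ≤ S.ncard → 2 * (S.ncard - 1) ≤ n := by
  induction n using Nat.strong_induction_on with
  | _ n ih =>
    intro A _ _ S hn hS hcard
    by_cases hperm : IsPermutational S
    · exact hn ▸ hS.two_mul_le_card_of_isPermutational hperm hcard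
    · simp only [IsPermutational] at hperm
      push Not at hperm
      obtain ⟨f, hf, hne, hbij⟩ := hperm
      obtain ⟨e, he, hidem, hene, z, hz⟩ :=
        hS.exists_idempotent (by omega) hf hne hbij
      have hlt : Nat.card {x // e x = x} < n := hn ▸ Finite.card_subtype_lt hz
      have : Nonempty {x // e x = x} := ⟨⟨e z, hidem z⟩⟩
      have hncard := (hS.injOn_comap_fixed (by omega) he hidem hene).ncard_image
      have hle := ih _ hlt rfl (hS.retract (by omega) he hidem hene) (by omega)
      omega

/-- Let `p` be an odd prime, `A` a finite nonempty set and `F` any set of unary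
operations on `A`. If the lattice of `F`-invariant equivalence relations on `A` is
isomorphic to `M_{p+1}` (the set of `F`-invariant setoids strictly between `⊥` and `⊤`
has exactly `p + 1` elements, any two distinct ones meeting in `⊥` and joining to `⊤`
among setoids), then `|A| ≥ 2p`. -/
theorem stmt_10 {A : Type*} [Fintype A] [Nonempty A] (F : Set (A → A))
    (p : ℕ) (hp : p.Prime) (hodd : Odd p)
    (hcard : {r : Setoid A | (∀ f ∈ F, ∀ x y : A, r x y → r (f x) (f y)) ∧
        ⊥ < r ∧ r < ⊤}.ncard = p + 1)
    (hMn : ∀ r r' : Setoid A,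
      r ∈ {r : Setoid A | (∀ f ∈ F, ∀ x y : A, r x y → r (f x) (f y)) ∧
        ⊥ < r ∧ r < ⊤} →
      r' ∈ {r : Setoid A | (∀ f ∈ F, ∀ x y : A, r x y → r (f x) (f y)) ∧
        ⊥ < r ∧ r < ⊤} →
      r ≠ r' → r ⊓ r' = ⊥ ∧ r ⊔ r' = ⊤) :
    2 * p ≤ Fintype.card A := by
  set S := {r : Setoid A | (∀ f ∈ F, ∀ x y : A, r x y → r (f x) (f y)) ∧ ⊥ < r ∧ r < ⊤}
  have hS : IsHeightTwoCongruences S :=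
    { ne_bot := fun r hr => hr.2.1.ne'
      ne_top := fun r hr => hr.2.2.ne
      eq_of_rel := fun r hr s hs hrs x y hxy hxy' => by
        have h : (r ⊓ s) x y := ⟨hxy, hxy'⟩
        rwa [(hMn r s hr hs hrs).1] at h
      sup_eq_top := fun r hr s hs hrs => (hMn r s hr hs hrs).2
      closed := fun r hr => by
        by_cases hbot : r = ⊥
        · exact Or.inl hbot
        by_cases htop : r = ⊤
        · exact Or.inr (Or.inl htop)
        exact Or.inr (Or.inr ⟨fun f hf => hr f fun s hs => hs.1 f hf,
          bot_lt_iff_ne_bot.2 hbot, lt_top_iff_ne_top.2 htop⟩) }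
  have h3 : 3 ≤ p := hp.two_le.lt_of_ne fun h => by
    rw [← h] at hodd
    exact absurd hodd (by decide)
  have hle := IsHeightTwoCongruences.two_mul_le_card _ Nat.card_eq_fintype_card hS (by omega)
  omega
end
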